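/- arXiv:math/0612100 — 4 statements merged into one kernel-verified Lean document; each statement's English description precedes it below -/
import Mathlib

section
/- Let p be a prime number and let γ = [[a, b], [c, d]] ∈ SL₂(ℤ) be a parabolic element (γ ≠ ±I and a + d = 2 or a + d = −2) whose upper-right entry b is divisible by p. Then either a ≡ 1 (mod p) and d ≡ 1 (mod p), or a ≡ −1 (mod p) and d ≡ −1 (mod p); that is, γ or −γ lies in Γ¹(p). -/
open Matrix

/-- If `[[a, b], [c, d]]` has determinant `1` and trace `2 * e` with `e ^ 2 = 1`, then modulo any
prime dividing `b` both diagonal entries are congruent to `e`. -/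
theorem Int.diag_modEq_of_trace_eq_two_mul {q a b c d e : ℤ} (hq : Prime q)
    (hdet : a * d - b * c = 1) (htr : a + d = 2 * e) (he : e ^ 2 = 1) (hb : q ∣ b) :
    a ≡ e [ZMOD q] ∧ d ≡ e [ZMOD q] := by
  have hsq : (e - a) ^ 2 = b * -c := by
    linear_combination he - hdet + a * htr
  have ha : q ∣ e - a := hq.dvd_of_dvd_pow (hsq ▸ hb.mul_right _)
  refine ⟨Int.modEq_iff_dvd.mpr ha, Int.modEq_iff_dvd.mpr ?_⟩
  rwa [show e - d = -(e - a) by linear_combination -htr, dvd_neg]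

/-- Lemma 3.2 of the paper.
Let `p` be a prime and `γ = [[a,b],[c,d]] ∈ SL₂(ℤ)` a parabolic element
(`γ ≠ ±I` and `a + d = ±2`) whose upper-right entry `b` is divisible by `p`.
Then either `a ≡ 1` and `d ≡ 1 (mod p)`, or `a ≡ -1` and `d ≡ -1 (mod p)`;
that is, `γ` or `-γ` lies in `Γ¹(p)`. -/
theorem parabolic_of_Gamma0_upper_is_in_Gamma1
    (p : ℕ) (hp : p.Prime)
    (γ : Matrix.SpecialLinearGroup (Fin 2) ℤ)
    (hγI : γ ≠ 1) (hγmI : γ ≠ -1)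
    (htr : (γ : Matrix (Fin 2) (Fin 2) ℤ) 0 0 + (γ : Matrix (Fin 2) (Fin 2) ℤ) 1 1 = 2 ∨
           (γ : Matrix (Fin 2) (Fin 2) ℤ) 0 0 + (γ : Matrix (Fin 2) (Fin 2) ℤ) 1 1 = -2)
    (hb : (p : ℤ) ∣ (γ : Matrix (Fin 2) (Fin 2) ℤ) 0 1) :
    ((γ : Matrix (Fin 2) (Fin 2) ℤ) 0 0 ≡ 1 [ZMOD p] ∧
      (γ : Matrix (Fin 2) (Fin 2) ℤ) 1 1 ≡ 1 [ZMOD p]) ∨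
    ((γ : Matrix (Fin 2) (Fin 2) ℤ) 0 0 ≡ -1 [ZMOD p] ∧
      (γ : Matrix (Fin 2) (Fin 2) ℤ) 1 1 ≡ -1 [ZMOD p]) := by
  have hdet := γ.det_coe
  rw [Matrix.det_fin_two] at hdet
  have hp' : Prime (p : ℤ) := Nat.prime_iff_prime_int.mp hp
  refine htr.imp (fun h => ?_) (fun h => ?_)
  · exact Int.diag_modEq_of_trace_eq_two_mul hp' hdet (by simpa using h) (by norm_num) hb
  · exact Int.diag_modEq_of_trace_eq_two_mul hp' hdet (by simpa using h) (by norm_num) hb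
end

section
/- Let n be a positive integer, G a finite group, and φ : Γ⁰(n) → G a group homomorphism such that φ(−I) = 1 and φ(γ) = 1 for every parabolic element γ of Γ⁰(n). If Γ¹(n) is not contained in ker φ, then ker φ, viewed as a subgroup of SL₂(ℤ), is not a congruence subgroup; i.e., ker φ contains no principal congruence subgroup Γ(m). -/
open Matrix Matrix.SpecialLinearGroup CongruenceSubgroup

open scoped MatrixGroups

/-- `Γ⁰(N)`: the congruence subgroup of `SL(2, ℤ)` of matrices whose upper
right-hand entry reduces to zero modulo `N`. -/
def GammaUpper0 (N : ℕ) : Subgroup SL(2, ℤ) where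
  carrier := { g | (g 0 1 : ZMod N) = 0 }
  one_mem' := by simp
  mul_mem' := by
    intro a b ha hb
    simp only [Set.mem_setOf_eq]
    have h := (Matrix.two_mul_expl a.1 b.1).2.1
    simp only [coe_matrix_coe, coe_mul, Int.coe_castRingHom, map_apply, Set.mem_setOf_eq] at *
    rw [h]
    simp [ha, hb]
  inv_mem' := by
    intro a ha
    simp only [Set.mem_setOf_eq]
    rw [SL2_inv_expl a]
    simp only [cons_val_zero, cons_val_one, head_cons, coe_matrix_coe,
      coe_mk, Int.coe_castRingHom, map_apply, Int.cast_neg, neg_eq_zero, Set.mem_setOf_eq] at *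
    exact ha

/-- `Γ¹(N)`: the congruence subgroup of `SL(2, ℤ)` of matrices whose upper
right-hand entry reduces to zero and whose diagonal entries reduce to one
modulo `N`. -/
def GammaUpper1 (N : ℕ) : Subgroup SL(2, ℤ) where
  carrier := { g | (g 0 1 : ZMod N) = 0 ∧ (g 0 0 : ZMod N) = 1 ∧ (g 1 1 : ZMod N) = 1 }
  one_mem' := by simp
  mul_mem' := by
    intro a b ha hb
    have h00 := (Matrix.two_mul_expl a.1 b.1).1
    have h01 := (Matrix.two_mul_expl a.1 b.1).2.1
    have h11 := (Matrix.two_mul_expl a.1 b.1).2.2.2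
    simp only [Set.mem_setOf_eq, coe_matrix_coe, coe_mul, Int.coe_castRingHom, map_apply] at *
    rw [h00, h01, h11]
    push_cast
    rw [ha.1, ha.2.1, ha.2.2, hb.1, hb.2.1, hb.2.2]
    simp
  inv_mem' := by
    intro a ha
    simp only [Set.mem_setOf_eq] at *
    rw [SL2_inv_expl a]
    simp only [cons_val_zero, cons_val_one, head_cons, coe_matrix_coe,
      coe_mk, Int.coe_castRingHom, map_apply, Int.cast_neg, neg_eq_zero] at *
    exact ⟨ha.1, ha.2.2, ha.2.1⟩

/-- An element of `SL(2, ℤ)` is parabolic if it is not `±I` and its trace is `±2`. -/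
def IsParabolic (γ : SL(2, ℤ)) : Prop :=
  γ ≠ 1 ∧ γ ≠ -1 ∧ ((γ 0 0 : ℤ) + γ 1 1 = 2 ∨ (γ 0 0 : ℤ) + γ 1 1 = -2)

namespace Matrix.SpecialLinearGroup

/-- The upper unipotent matrix with upper right-hand entry `t`. -/
def upperUnipotent (t : ℤ) : SL(2, ℤ) := ⟨!![1, t; 0, 1], by simp⟩

@[simp]
theorem coe_upperUnipotent (t : ℤ) :
    (upperUnipotent t : Matrix (Fin 2) (Fin 2) ℤ) = !![1, t; 0, 1] := rfl

/-- The lower unipotent matrix with lower left-hand entry `t`. -/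
def lowerUnipotent (t : ℤ) : SL(2, ℤ) := ⟨!![1, 0; t, 1], by simp⟩

@[simp]
theorem coe_lowerUnipotent (t : ℤ) :
    (lowerUnipotent t : Matrix (Fin 2) (Fin 2) ℤ) = !![1, 0; t, 1] := rfl

end Matrix.SpecialLinearGroup

/-- An integer in the residue class of `b` modulo `a`, for `a` and `b` coprime, can be chosen
coprime to any given nonzero integer. -/
theorem Int.exists_isCoprime_add_mul {a b : ℤ} (h : IsCoprime a b) {m : ℤ} (hm : m ≠ 0) :
    ∃ k : ℤ, IsCoprime (b + k * a) m := by
  classical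
  let s : Finset ℕ := m.natAbs.primeFactors.filter fun p : ℕ => ¬ (p : ℤ) ∣ b
  refine ⟨∏ p ∈ s, (p : ℤ), ?_⟩
  rw [Int.isCoprime_iff_gcd_eq_one]
  refine Nat.Coprime.symm (Nat.coprime_of_dvd fun p hp hpm hpx => ?_)
  have hpx : (p : ℤ) ∣ b + (∏ p ∈ s, (p : ℤ)) * a := Int.natCast_dvd.2 hpx
  have hpp : Prime (p : ℤ) := Nat.prime_iff_prime_int.1 hp
  by_cases hb : (p : ℤ) ∣ b
  · rcases hpp.dvd_or_dvd ((dvd_add_right hb).1 hpx) with h' | h'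
    · obtain ⟨q, hq, hpq⟩ := (hpp.dvd_finsetProd_iff _).1 h'
      obtain ⟨hq, hqb⟩ := Finset.mem_filter.1 hq
      have := (Nat.prime_dvd_prime_iff_eq hp (Nat.prime_of_mem_primeFactors hq)).1
        (Int.natCast_dvd_natCast.1 hpq)
      exact hqb (this ▸ hb)
    · exact hpp.not_isUnit (h.isUnit_of_dvd' h' hb)
  · have hs : p ∈ s := Finset.mem_filter.2
      ⟨Nat.mem_primeFactors.2 ⟨hp, hpm, Int.natAbs_ne_zero.2 hm⟩, hb⟩
    exact hb ((dvd_add_left ((Finset.dvd_prod_of_mem _ hs).mul_right a)).1 hpx)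

/-- A subgroup of `SL(2, ℤ)` containing a principal congruence subgroup, all lower unipotent
matrices and the upper unipotent matrices of `Γ¹(n)` contains `Γ¹(n)`. -/
theorem GammaUpper1_le_of_unipotent_mem {n m : ℕ} (hm : m ≠ 0) {K : Subgroup SL(2, ℤ)}
    (hL : ∀ t, lowerUnipotent t ∈ K) (hU : ∀ t, upperUnipotent (n * t) ∈ K)
    (hK : Gamma m ≤ K) : GammaUpper1 n ≤ K := by
  intro g hg
  obtain ⟨h01, h00, -⟩ := hg
  obtain ⟨b, hb⟩ := (ZMod.intCast_zmod_eq_zero_iff_dvd _ _).1 h01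
  obtain ⟨x, hx⟩ := (ZMod.intCast_eq_intCast_iff_dvd_sub (g 0 0) 1 n).1 (by simpa using h00)
  have hdet := g.det_coe
  rw [Matrix.det_fin_two] at hdet
  have hcop : IsCoprime (g 0 0) b := ⟨g 1 1, -(n * g 1 0), by linear_combination hdet + g 1 0 * hb⟩
  obtain ⟨k, u, v, huv⟩ := Int.exists_isCoprime_add_mul hcop (Nat.cast_ne_zero.2 hm : (m : ℤ) ≠ 0)
  -- After the first two factors the upper left-hand entry is `1` modulo `m`.
  set h := g * upperUnipotent (n * k) * lowerUnipotent (x * u) with h_def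
  have e00 : h 0 0 = 1 - n * x * v * m := by
    simp [h_def, Matrix.mul_apply, Fin.sum_univ_two]
    linear_combination -hx + x * u * hb + n * x * huv
  have e01 : h 0 1 = n * (b + k * g 0 0) := by
    simp [h_def, Matrix.mul_apply, Fin.sum_univ_two]
    linear_combination hb
  have hdet' := h.det_coe
  rw [Matrix.det_fin_two] at hdet'
  suffices hh : h ∈ K by
    rw [h_def] at hh
    exact (K.mul_mem_cancel_right (hU k)).1 ((K.mul_mem_cancel_right (hL _)).1 hh)
  suffices hh : lowerUnipotent (-h 1 0) * (h * upperUnipotent (n * -(b + k * g 0 0))) ∈ Gamma m from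
    (K.mul_mem_cancel_right (hU _)).1 ((K.mul_mem_cancel_left (hL _)).1 (hK hh))
  have c00 : (h 0 0 : ZMod m) = 1 := by rw [e00]; simp
  have c01 : (h 0 1 : ZMod m) = n * (b + k * g 0 0) := by rw [e01]; simp
  have cdet : (h 0 0 * h 1 1 - h 0 1 * h 1 0 : ZMod m) = 1 := by
    exact_mod_cast congrArg (Int.cast : ℤ → ZMod m) hdet'
  rw [c00, c01] at cdet
  rw [Gamma_mem]
  simp [Matrix.mul_apply, Fin.sum_univ_two, c00, c01]
  exact ⟨by ring, by linear_combination cdet⟩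

theorem isParabolic_upperUnipotent {t : ℤ} (ht : t ≠ 0) : IsParabolic (upperUnipotent t) := by
  refine ⟨fun h => ht ?_, fun h => ht ?_, Or.inl ?_⟩
  · simpa using congrArg (fun g : SL(2, ℤ) => g 0 1) h
  · simpa using congrArg (fun g : SL(2, ℤ) => g 0 1) h
  · simp

theorem isParabolic_lowerUnipotent {t : ℤ} (ht : t ≠ 0) : IsParabolic (lowerUnipotent t) := by
  refine ⟨fun h => ht ?_, fun h => ht ?_, Or.inl ?_⟩
  · simpa using congrArg (fun g : SL(2, ℤ) => g 1 0) h
  · simpa using congrArg (fun g : SL(2, ℤ) => g 1 0) h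
  · simp

/-- Proposition 3.3 of the paper.
Let `n ≥ 1`, `G` a finite group, and `φ : Γ⁰(n) → G` a homomorphism killing `-I`
and all parabolic elements of `Γ⁰(n)`.  If `Γ¹(n)` is not contained in `ker φ`,
then `ker φ` (viewed inside `SL(2, ℤ)`) is not a congruence subgroup, i.e. it
contains no principal congruence subgroup `Γ(m)`. -/
theorem kernel_of_typeII_hom_on_GammaUpper0_noncongruence
    (n : ℕ) (hn : 0 < n) {G : Type*} [Group G] [Finite G]
    (φ : GammaUpper0 n →* G)
    (hI : ∀ γ : GammaUpper0 n, (γ : SL(2, ℤ)) = -1 → φ γ = 1)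
    (hpar : ∀ γ : GammaUpper0 n, IsParabolic (γ : SL(2, ℤ)) → φ γ = 1)
    (hker : ¬ GammaUpper1 n ≤ Subgroup.map (GammaUpper0 n).subtype φ.ker) :
    ∀ m : ℕ, 1 ≤ m →
      ¬ CongruenceSubgroup.Gamma m ≤ Subgroup.map (GammaUpper0 n).subtype φ.ker := by
  intro m hm hle
  have hmem {γ : SL(2, ℤ)} (hγ : γ ∈ GammaUpper0 n) (h : γ = 1 ∨ IsParabolic γ) :
      γ ∈ Subgroup.map (GammaUpper0 n).subtype φ.ker := by
    rcases h with rfl | h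
    · exact one_mem _
    · exact ⟨⟨γ, hγ⟩, hpar ⟨γ, hγ⟩ h, rfl⟩
  refine hker (GammaUpper1_le_of_unipotent_mem (by omega) (fun t => ?_) (fun t => ?_) hle)
  · refine hmem (show ((lowerUnipotent t 0 1 : ℤ) : ZMod n) = 0 by simp) ?_
    rcases eq_or_ne t 0 with rfl | ht
    · exact Or.inl (by ext i j; fin_cases i <;> fin_cases j <;> simp)
    · exact Or.inr (isParabolic_lowerUnipotent ht)
  · refine hmem (show ((upperUnipotent (n * t) 0 1 : ℤ) : ZMod n) = 0 by simp) ?_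
    rcases eq_or_ne t 0 with rfl | ht
    · exact Or.inl (by ext i j; fin_cases i <;> fin_cases j <;> simp)
    · exact Or.inr (isParabolic_upperUnipotent (mul_ne_zero (by exact_mod_cast hn.ne') ht))
end

section
/- Let l, m, s, v be positive integers and let n, u be integers. Let Λ₁ be the subgroup of ℤ × ℤ generated by (l, n) and (0, m), and let Λ₂ be the subgroup of ℤ × ℤ generated by (s, u) and (0, v). Then Λ₁ + Λ₂ = ℤ × ℤ if and only if gcd(s, l) = 1 and gcd(v, gcd(m, s·n − u·l)) = 1. -/
/-- Three integers have greatest common divisor `1` iff they satisfy a Bézout identity. -/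
theorem Int.gcd_gcd_eq_one_iff_exists (a b c : ℤ) :
    Int.gcd a (Int.gcd b c : ℤ) = 1 ↔ ∃ x y z : ℤ, x * a + y * b + z * c = 1 := by
  constructor
  · intro h
    obtain ⟨p, q, hpq⟩ := Int.isCoprime_iff_gcd_eq_one.mpr h
    rw [Int.gcd_eq_gcd_ab b c] at hpq
    exact ⟨p, q * Int.gcdA b c, q * Int.gcdB b c, by linear_combination hpq⟩
  · rintro ⟨x, y, z, h⟩
    obtain ⟨b', hb⟩ := Int.gcd_dvd_left b c
    obtain ⟨c', hc⟩ := Int.gcd_dvd_right b c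
    refine Int.isCoprime_iff_gcd_eq_one.mp ⟨x, y * b' + z * c', ?_⟩
    linear_combination h - y * hb - z * hc

/-- Coordinates of the elements of the sum of two sublattices of `ℤ × ℤ` in normal form. -/
theorem mem_closure_pair_sup_closure_pair_iff (l m s v n u x y : ℤ) :
    ((x, y) : ℤ × ℤ) ∈ AddSubgroup.closure {((l, n) : ℤ × ℤ), (0, m)} ⊔
        AddSubgroup.closure {((s, u) : ℤ × ℤ), (0, v)} ↔
      ∃ a b c d : ℤ, a * l + c * s = x ∧ a * n + b * m + (c * u + d * v) = y := by
  simp only [AddSubgroup.mem_sup, AddSubgroup.mem_closure_pair]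
  constructor
  · rintro ⟨_, ⟨a, b, rfl⟩, _, ⟨c, d, rfl⟩, h⟩
    simp only [Prod.smul_mk, smul_eq_mul, Prod.mk_add_mk, Prod.mk.injEq, mul_zero,
      add_zero] at h
    exact ⟨a, b, c, d, h⟩
  · rintro ⟨a, b, c, d, rfl, rfl⟩
    exact ⟨_, ⟨a, b, rfl⟩, _, ⟨c, d, rfl⟩, by simp⟩

/-- Lemma 4.9 of the paper.
Let `l, m, s, v` be positive integers and `n, u` integers.  Let
`Λ₁ = ⟨(l, n), (0, m)⟩` and `Λ₂ = ⟨(s, u), (0, v)⟩` as subgroups of `ℤ × ℤ`.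
Then `Λ₁ + Λ₂ = ℤ × ℤ` if and only if
`gcd(s, l) = 1` and `gcd(v, gcd(m, s·n − u·l)) = 1`. -/
theorem sublattices_generate_iff_gcd_conditions
    (l m s v : ℤ) (n u : ℤ) (hl : 0 < l) (hm : 0 < m) (hs : 0 < s) (hv : 0 < v) :
    AddSubgroup.closure {((l, n) : ℤ × ℤ), (0, m)} ⊔
        AddSubgroup.closure {((s, u) : ℤ × ℤ), (0, v)} = ⊤ ↔
      Int.gcd s l = 1 ∧ Int.gcd v (Int.gcd m (s * n - u * l) : ℤ) = 1 := by
  rw [Int.gcd_gcd_eq_one_iff_exists, ← Int.isCoprime_iff_gcd_eq_one, AddSubgroup.eq_top_iff']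
  simp only [Prod.forall, mem_closure_pair_sup_closure_pair_iff]
  constructor
  · intro h
    obtain ⟨q, -, p, -, hpq, -⟩ := h 1 0
    have hsl : IsCoprime s l := ⟨p, q, by linear_combination hpq⟩
    refine ⟨hsl, ?_⟩
    obtain ⟨a, b, c, d, h₀, h₁⟩ := h 0 1
    obtain ⟨t, rfl⟩ : s ∣ a := hsl.dvd_of_dvd_mul_right ⟨-c, by linear_combination h₀⟩
    have hc : c = -(l * t) :=
      mul_left_cancel₀ hs.ne' (by linear_combination h₀)
    subst hc
    exact ⟨d, b, t, by linear_combination h₁⟩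
  · rintro ⟨⟨p, q, hpq⟩, d, b, t, h⟩ x y
    refine ⟨x * q + s * (t * (y - x * (q * n + p * u))), b * (y - x * (q * n + p * u)),
      x * p - l * (t * (y - x * (q * n + p * u))), d * (y - x * (q * n + p * u)), ?_, ?_⟩
    · linear_combination x * hpq
    · linear_combination (y - x * (q * n + p * u)) * h
end

section
/- Let B be a finite-index subgroup of ℤ × ℤ. Then there exists a constant c > 0 such that for all sufficiently large X, the number of subgroups Λ of ℤ × ℤ of finite index strictly less than X satisfying Λ + B = ℤ × ℤ is greater than c·X². -/
/-- Subgroups of `ℤ × ℤ` whose index is nonzero and less than `X` form a finite set: all of them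
contain the kernel of reduction modulo `X !`. -/
lemma finite_setOf_index_lt (X : ℕ) :
    {Λ : AddSubgroup (ℤ × ℤ) | Λ.index ≠ 0 ∧ Λ.index < X}.Finite := by
  have : NeZero X.factorial := ⟨X.factorial_ne_zero⟩
  let π : ℤ × ℤ →+ ZMod X.factorial × ZMod X.factorial :=
    (Int.castAddHom (ZMod X.factorial)).prodMap (Int.castAddHom (ZMod X.factorial))
  have hker : ∀ Λ : AddSubgroup (ℤ × ℤ), Λ.index ≠ 0 ∧ Λ.index < X → π.ker ≤ Λ := by
    rintro Λ ⟨h0, hlt⟩ ⟨x, y⟩ hxy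
    have hxy' : (x : ZMod X.factorial) = 0 ∧ (y : ZMod X.factorial) = 0 := by
      simpa [π, AddMonoidHom.mem_ker] using hxy
    obtain ⟨d, hd⟩ := Nat.dvd_factorial (Nat.pos_of_ne_zero h0) hlt.le
    obtain ⟨a, rfl⟩ := (ZMod.intCast_zmod_eq_zero_iff_dvd _ _).1 hxy'.1
    obtain ⟨b, rfl⟩ := (ZMod.intCast_zmod_eq_zero_iff_dvd _ _).1 hxy'.2
    have := Λ.nsmul_index_mem ((d * a, d * b) : ℤ × ℤ)
    simpa [hd, mul_assoc] using this
  refine Set.Finite.of_finite_image (f := AddSubgroup.map π) (Set.toFinite _) ?_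
  intro Λ hΛ Λ' hΛ' h
  have := congrArg (AddSubgroup.comap π) h
  rwa [AddSubgroup.comap_map_eq_self (hker Λ hΛ),
    AddSubgroup.comap_map_eq_self (hker Λ' hΛ')] at this

/-- The homomorphism `(x, y) ↦ y - b * x` modulo `n`. -/
def slopeHom (n : ℕ) (b : ℤ) : ℤ × ℤ →+ ZMod n :=
  (Int.castAddHom (ZMod n)).comp
    (AddMonoidHom.snd ℤ ℤ - (AddMonoidHom.mulLeft b).comp (AddMonoidHom.fst ℤ ℤ))

lemma slopeHom_apply (n : ℕ) (b : ℤ) (v : ℤ × ℤ) :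
    slopeHom n b v = ((v.2 - b * v.1 : ℤ) : ZMod n) := rfl

lemma index_ker_slopeHom (n : ℕ) (b : ℤ) : (slopeHom n b).ker.index = n := by
  have hsurj : Function.Surjective (slopeHom n b) := by
    intro z
    obtain ⟨y, rfl⟩ := ZMod.intCast_surjective z
    exact ⟨(0, y), by simp [slopeHom_apply]⟩
  rw [AddSubgroup.index_ker, AddMonoidHom.range_eq_top.2 hsurj, AddSubgroup.card_top,
    Nat.card_zmod]

lemma ker_slopeHom_injective {n n' b b' : ℕ} (hb : b < n) (hb' : b' < n')
    (h : (slopeHom n b).ker = (slopeHom n' b').ker) : n = n' ∧ b = b' := by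
  have hn : n = n' := by rw [← index_ker_slopeHom n b, h, index_ker_slopeHom]
  subst hn
  refine ⟨rfl, ?_⟩
  have hmem : ((1, (b : ℤ)) : ℤ × ℤ) ∈ (slopeHom n b').ker := by
    rw [← h, AddMonoidHom.mem_ker, slopeHom_apply]
    simp
  rw [AddMonoidHom.mem_ker, slopeHom_apply] at hmem
  have hmod : (b : ZMod n) = (b' : ZMod n) := by
    rw [← sub_eq_zero]
    simpa using hmem
  exact Nat.ModEq.eq_of_lt_of_lt ((ZMod.natCast_eq_natCast_iff _ _ _).1 hmod) hb hb'

lemma sup_eq_top_of_coprime_index {G : Type*} [AddGroup G] {H K : AddSubgroup G}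
    (h : H.index.Coprime K.index) : H ⊔ K = ⊤ :=
  AddSubgroup.index_eq_one.1 <| Nat.eq_one_of_dvd_coprimes h
    (AddSubgroup.index_dvd_of_le le_sup_left) (AddSubgroup.index_dvd_of_le le_sup_right)

/-- The sublattices `(slopeHom (m * (K + i) + 1) j).ker` with `i, j < K` and `m = B.index` are
pairwise distinct, and each of them spans `ℤ × ℤ` together with `B`. -/
lemma sq_le_card_sublattices (B : AddSubgroup (ℤ × ℤ)) (hB : B.index ≠ 0) {K X : ℕ}
    (hX : 2 * B.index * K < X) :
    K ^ 2 ≤ Nat.card {Λ : AddSubgroup (ℤ × ℤ) //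
      Λ.index ≠ 0 ∧ Λ.index < X ∧ Λ ⊔ B = ⊤} := by
  have : Finite {Λ : AddSubgroup (ℤ × ℤ) // Λ.index ≠ 0 ∧ Λ.index < X ∧ Λ ⊔ B = ⊤} :=
    ((finite_setOf_index_lt X).subset fun _ h ↦ ⟨h.1, h.2.1⟩).to_subtype
  have hm : 1 ≤ B.index := Nat.one_le_iff_ne_zero.2 hB
  let n (i : Fin K) : ℕ := B.index * (K + i) + 1
  have hlt (i : Fin K) : n i < X := by
    have := Nat.mul_le_mul_left B.index (show K + i + 1 ≤ 2 * K by omega)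
    simp only [n]
    nlinarith
  have hb (i j : Fin K) : (j : ℕ) < n i := by
    have := Nat.mul_le_mul_right (K + i) hm
    simp only [n]
    omega
  let f (p : Fin K × Fin K) : {Λ : AddSubgroup (ℤ × ℤ) //
      Λ.index ≠ 0 ∧ Λ.index < X ∧ Λ ⊔ B = ⊤} :=
    ⟨(slopeHom (n p.1) (p.2 : ℕ)).ker, by
      refine ⟨?_, ?_, sup_eq_top_of_coprime_index ?_⟩
      · simp [index_ker_slopeHom, n]
      · simpa [index_ker_slopeHom] using hlt p.1
      · simp [index_ker_slopeHom, n]⟩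
  have hf : Function.Injective f := by
    rintro ⟨i, j⟩ ⟨i', j'⟩ h
    obtain ⟨h₁, h₂⟩ := ker_slopeHom_injective (hb i j) (hb i' j') (congrArg Subtype.val h)
    have h₃ : K + (i : ℕ) = K + i' := Nat.eq_of_mul_eq_mul_left hm (Nat.succ_injective h₁)
    exact Prod.ext (Fin.ext (by simpa using h₃)) (Fin.ext h₂)
  simpa [sq] using Nat.card_le_card_of_injective f hf


/-- lattice-theoretic content of Lemma 4.10 of the paper.
Let `B` be a finite-index subgroup of `ℤ × ℤ`.  Then there is a constant
`c > 0` such that for all sufficiently large `X`, the number of subgroups `Λ`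
of `ℤ × ℤ` of finite index strictly less than `X` with `Λ + B = ℤ × ℤ` is
greater than `c·X²`. -/
theorem count_sublattices_joining_with_B_lower_bound
    (B : AddSubgroup (ℤ × ℤ)) (hB : B.index ≠ 0) :
    ∃ c : ℝ, 0 < c ∧ ∀ᶠ X : ℕ in Filter.atTop,
      c * (X : ℝ) ^ 2 <
        (Nat.card {Λ : AddSubgroup (ℤ × ℤ) //
          Λ.index ≠ 0 ∧ Λ.index < X ∧ Λ ⊔ B = ⊤} : ℝ) := by
  have hm : (0 : ℝ) < B.index := Nat.cast_pos.2 (Nat.pos_of_ne_zero hB)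
  refine ⟨1 / (128 * (B.index : ℝ) ^ 2), by positivity, ?_⟩
  filter_upwards [Filter.eventually_ge_atTop (8 * B.index)] with X hX
  have hm' : 0 < B.index := Nat.pos_of_ne_zero hB
  set K := X / (4 * B.index)
  have hK : 4 * B.index * K ≤ X := Nat.mul_div_le _ _
  have hK' : X < 4 * B.index * (K + 1) := Nat.lt_mul_div_succ _ (by positivity)
  have hcard := sq_le_card_sublattices B hB (K := K) (X := X) (by linarith)
  have hXK : (X : ℝ) ≤ 8 * B.index * K := by
    have h₁ : (X : ℝ) < 4 * B.index * (K + 1) := mod_cast hK'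
    have h₂ : (8 * B.index : ℝ) ≤ X := mod_cast hX
    linarith
  have hXpos : (0 : ℝ) < X := Nat.cast_pos.2 (by omega)
  calc 1 / (128 * (B.index : ℝ) ^ 2) * (X : ℝ) ^ 2
      < 1 / (64 * (B.index : ℝ) ^ 2) * (X : ℝ) ^ 2 := by gcongr; norm_num
    _ ≤ 1 / (64 * (B.index : ℝ) ^ 2) * (8 * B.index * K) ^ 2 := by gcongr
    _ = (K : ℝ) ^ 2 := by field_simp; norm_num
    _ ≤ _ := mod_cast hcard
end
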